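/- arXiv:1302.1017 — 2 statements merged into one kernel-verified Lean document; each statement's English description precedes it below -/
import Mathlib

section
/- Let r ≥ 1/8 and let (Y₁,Y₂,Y₃) be a centered Gaussian random vector in ℝ³ with covariance matrix Σ(r). For u ∈ ℝ let M denote the random 2×2 symmetric matrix with rows (Y₁ − u, Y₂) and (Y₂, Y₃ − u). Then E[ |(Y₁ − u)(Y₃ − u) − Y₂²| · 1_{M is negative semidefinite} ] ≤ u² − 1 + (8r)^{3/2}·exp(−u²/(24r − 2))/√(24r − 2). -/
open MeasureTheory ProbabilityTheory Real Matrix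

theorem map_prodMk_eq_prod_gaussianReal {Ω : Type*} {mΩ : MeasurableSpace Ω} {μ : Measure Ω}
    [IsProbabilityMeasure μ] {X Y Z : Ω → ℝ} (hX : Measurable X) (hY : Measurable Y)
    (hZ : Measurable Z) {p q w : ℝ} (hp : 0 ≤ p) (hq : 0 ≤ q) (hw : 0 ≤ w)
    (h : ∀ a b c : ℝ, μ.map (fun ω ↦ a * X ω + b * Y ω + c * Z ω) =
      gaussianReal 0 (p * a ^ 2 + q * b ^ 2 + w * c ^ 2).toNNReal) :
    μ.map (fun ω ↦ (X ω, Y ω, Z ω)) = (gaussianReal 0 p.toNNReal).prod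
      ((gaussianReal 0 q.toNNReal).prod (gaussianReal 0 w.toNNReal)) := by
  have : IsProbabilityMeasure (μ.map (fun ω ↦ (X ω, Y ω, Z ω))) :=
    Measure.isProbabilityMeasure_map (by fun_prop)
  have key (v : ℝ) (hv : 0 ≤ v) (L : StrongDual ℝ ℝ) :
      charFunDual (gaussianReal 0 v.toNNReal) L = Complex.exp (-(v * L 1 ^ 2 / 2)) := by
    have hL : (L : ℝ → ℝ) = fun x ↦ L 1 * x := by
      ext x
      simpa [mul_comm] using L.map_smul x 1
    rw [charFunDual_eq_charFun_map_one, hL, gaussianReal_map_const_mul, charFun_gaussianReal]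
    simp [hv, mul_comm]
  refine Measure.ext_of_charFunDual (funext fun L ↦ ?_)
  have hL (x y z : ℝ) : L (x, y, z) = L (1, 0, 0) * x + L (0, 1, 0) * y + L (0, 0, 1) * z := by
    have : (x, y, z) = x • ((1 : ℝ), (0 : ℝ), (0 : ℝ)) + y • ((0 : ℝ), (1 : ℝ), (0 : ℝ))
      + z • ((0 : ℝ), (0 : ℝ), (1 : ℝ)) := by simp
    rw [this]
    simp only [map_add, map_smul, smul_eq_mul]
    ring
  rw [charFunDual_prod, charFunDual_prod, key p hp, key q hq, key w hw,
    charFunDual_eq_charFun_map_one, Measure.map_map (by fun_prop) (by fun_prop)]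
  have hcomp : L ∘ (fun ω ↦ (X ω, Y ω, Z ω)) = fun ω ↦
      L (1, 0, 0) * X ω + L (0, 1, 0) * Y ω + L (0, 0, 1) * Z ω := funext fun ω ↦ hL _ _ _
  rw [hcomp, h, charFun_gaussianReal, ← Complex.exp_add, ← Complex.exp_add]
  congr 1
  have h1 : ((1 : ℝ), (0 : ℝ × ℝ)) = (1, 0, 0) := rfl
  rw [Real.coe_toNNReal _ (by positivity)]
  simp [h1]
  ring

theorem integral_mul_max_sq_sub_sq_mul_exp {v : ℝ} (hv : 0 < v) (x : ℝ) :
    ∫ s in Set.Ioi (0 : ℝ), s * max (x ^ 2 - s ^ 2) 0 * exp (-s ^ 2 / (2 * v)) =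
      v * (x ^ 2 - 2 * v + 2 * v * exp (-x ^ 2 / (2 * v))) := by
  have hsub : Set.Ioc 0 |x| ⊆ Set.Ioi (0 : ℝ) := fun s hs ↦ hs.1
  rw [setIntegral_eq_of_subset_of_forall_sdiff_eq_zero measurableSet_Ioi hsub,
    ← intervalIntegral.integral_of_le (abs_nonneg x)]
  · have hderiv (s : ℝ) : HasDerivAt
        (fun s ↦ (-(v * (x ^ 2 - s ^ 2)) + 2 * v ^ 2) * exp (-s ^ 2 / (2 * v)))
        (s * (x ^ 2 - s ^ 2) * exp (-s ^ 2 / (2 * v))) s := by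
      have h2 : HasDerivAt (fun s : ℝ ↦ s ^ 2) (2 * s) s := by simpa using hasDerivAt_pow 2 s
      have := (((h2.const_sub (x ^ 2)).const_mul v).neg.add_const (2 * v ^ 2)).mul
        ((h2.neg.div_const (2 * v)).exp)
      convert! this using 1
      simp
      field_simp
      ring
    have heq : ∫ s in (0 : ℝ)..|x|, s * max (x ^ 2 - s ^ 2) 0 * exp (-s ^ 2 / (2 * v)) =
        ∫ s in (0 : ℝ)..|x|, s * (x ^ 2 - s ^ 2) * exp (-s ^ 2 / (2 * v)) := by
      refine intervalIntegral.integral_congr fun s hs ↦ ?_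
      rw [Set.uIcc_of_le (abs_nonneg x)] at hs
      have : s ^ 2 ≤ x ^ 2 := by rw [← sq_abs x]; exact pow_le_pow_left₀ hs.1 hs.2 2
      rw [max_eq_left (by linarith)]
    rw [heq, intervalIntegral.integral_eq_sub_of_hasDerivAt (fun s _ ↦ hderiv s)
      (Continuous.intervalIntegrable (by fun_prop) _ _)]
    simp
    ring
  · intro s hs
    have hs' : |x| < s := by
      by_contra! hle
      exact hs.2 ⟨hs.1, hle⟩
    have : x ^ 2 ≤ s ^ 2 := by rw [← sq_abs x]; exact pow_le_pow_left₀ (abs_nonneg x) hs'.le 2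
    rw [max_eq_right (by linarith)]
    simp

theorem integral_max_sq_sub_sq_sub_sq_gaussianReal {v : ℝ} (hv : 0 < v) (x : ℝ) :
    ∫ p : ℝ × ℝ, max (x ^ 2 - p.1 ^ 2 - p.2 ^ 2) 0
        ∂(gaussianReal 0 v.toNNReal).prod (gaussianReal 0 v.toNNReal) =
      x ^ 2 - 2 * v + 2 * v * exp (-x ^ 2 / (2 * v)) := by
  have hv' : v.toNNReal ≠ 0 := by simpa using hv
  have hpdf (s t : ℝ) : gaussianPDFReal 0 v.toNNReal s * gaussianPDFReal 0 v.toNNReal t =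
      (2 * π * v)⁻¹ * exp (-(s ^ 2 + t ^ 2) / (2 * v)) := by
    simp only [gaussianPDFReal, Real.coe_toNNReal _ hv.le, sub_zero]
    rw [mul_mul_mul_comm, ← mul_inv, Real.mul_self_sqrt (by positivity), ← Real.exp_add]
    congr 2
    ring
  rw [gaussianReal_of_var_ne_zero _ hv', prod_withDensity (by fun_prop) (by fun_prop),
    ← Measure.volume_eq_prod, integral_withDensity_eq_integral_toReal_smul (by fun_prop)
      (ae_of_all _ fun p ↦ ENNReal.mul_lt_top gaussianPDF_lt_top gaussianPDF_lt_top)]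
  simp only [ENNReal.toReal_mul, toReal_gaussianPDF, smul_eq_mul, hpdf]
  rw [← integral_comp_polarCoord_symm, polarCoord_target]
  have hcs (p : ℝ × ℝ) : (p.1 * cos p.2) ^ 2 + (p.1 * sin p.2) ^ 2 = p.1 ^ 2 := by
    linear_combination p.1 ^ 2 * sin_sq_add_cos_sq p.2
  have hint (p : ℝ × ℝ) : p.1 • ((2 * π * v)⁻¹ *
      exp (-((polarCoord.symm p).1 ^ 2 + (polarCoord.symm p).2 ^ 2) / (2 * v)) *
      max (x ^ 2 - (polarCoord.symm p).1 ^ 2 - (polarCoord.symm p).2 ^ 2) 0) =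
      (p.1 * max (x ^ 2 - p.1 ^ 2) 0 * exp (-p.1 ^ 2 / (2 * v))) * (2 * π * v)⁻¹ := by
    simp only [polarCoord_symm_apply, sub_sub, hcs, smul_eq_mul]
    ring
  simp only [hint]
  rw [Measure.volume_eq_prod, setIntegral_prod_mul
    (fun s ↦ s * max (x ^ 2 - s ^ 2) 0 * exp (-s ^ 2 / (2 * v))) (fun _ ↦ (2 * π * v)⁻¹),
    integral_mul_max_sq_sub_sq_mul_exp hv]
  have := pi_pos
  simp [this.le]
  field_simp
  ring

theorem integral_exp_neg_sub_sq_gaussianReal {w v : ℝ} (hw : 0 ≤ w) (hv : 0 < v) (u : ℝ) :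
    ∫ s, exp (-(u - s) ^ 2 / (2 * v)) ∂gaussianReal 0 w.toNNReal =
      √(v / (v + w)) * exp (-u ^ 2 / (2 * (v + w))) := by
  obtain rfl | hw := hw.eq_or_lt
  · simp [hv.ne']
  have hw' : w.toNNReal ≠ 0 := by simpa using hw
  rw [integral_gaussianReal_eq_integral_smul hw']
  have hsq (s : ℝ) : gaussianPDFReal 0 w.toNNReal s • exp (-(u - s) ^ 2 / (2 * v)) =
      (√(2 * π * w))⁻¹ * exp (-u ^ 2 / (2 * (v + w))) *
        exp (-((v + w) / (2 * v * w)) * (s - u * w / (v + w)) ^ 2) := by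
    simp only [gaussianPDFReal, Real.coe_toNNReal _ hw.le, sub_zero, smul_eq_mul, mul_assoc,
      ← Real.exp_add]
    congr 2
    field_simp
    ring
  simp only [hsq]
  rw [integral_const_mul, integral_sub_right_eq_self
      (fun s ↦ exp (-((v + w) / (2 * v * w)) * s ^ 2)),
    integral_gaussian, mul_right_comm, ← Real.sqrt_inv, ← Real.sqrt_mul (by positivity)]
  congr 2
  field_simp

theorem integral_sub_sq_gaussianReal (u : ℝ) (w : NNReal) :
    ∫ s, (u - s) ^ 2 ∂gaussianReal 0 w = u ^ 2 + w := by
  have h2 : ∫ s, s ^ 2 ∂gaussianReal 0 w = w := by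
    have := variance_id_gaussianReal (μ := 0) (v := w)
    rwa [variance_of_integral_eq_zero (by fun_prop) (by simp)] at this
  have i1 : Integrable (fun s : ℝ ↦ s) (gaussianReal 0 w) :=
    (memLp_id_gaussianReal 1).integrable (by simp)
  have i2 : Integrable (fun s : ℝ ↦ s ^ 2) (gaussianReal 0 w) :=
    (memLp_id_gaussianReal 2).integrable_sq
  have : (fun s ↦ (u - s) ^ 2) = fun s ↦ u ^ 2 - 2 * u * s + s ^ 2 := by ext; ring
  have i3 : Integrable (fun s : ℝ ↦ u ^ 2 - 2 * u * s) (gaussianReal 0 w) :=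
    (integrable_const _).sub (i1.const_mul _)
  rw [this, integral_add i3 i2,
    integral_sub (integrable_const _) (i1.const_mul _),
    integral_const_mul, h2, integral_id_gaussianReal]
  simp

theorem abs_det_mul_indicator_le {a b c : ℝ}
    [Decidable (∀ v : Fin 2 → ℝ, v ⬝ᵥ (!![a, b; b, c] *ᵥ v) ≤ 0)] :
    |a * c - b ^ 2| * (if ∀ v : Fin 2 → ℝ, v ⬝ᵥ (!![a, b; b, c] *ᵥ v) ≤ 0 then (1 : ℝ) else 0) ≤
      max (a * c - b ^ 2) 0 := by
  split_ifs with h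
  · have hdet : 0 ≤ a * c - b ^ 2 := by
      have hq (s t : ℝ) : a * s ^ 2 + 2 * b * s * t + c * t ^ 2 ≤ 0 := by
        have := h ![s, t]
        simp [Matrix.mulVec, dotProduct, Fin.sum_univ_two] at this
        linarith
      rcases (show a ≤ 0 by simpa using hq 1 0).lt_or_eq with ha | rfl
      · have := hq b (-a)
        by_contra! hneg
        nlinarith [mul_pos_of_neg_of_neg ha hneg]
      · rcases (show c ≤ 0 by simpa using hq 0 1).lt_or_eq with hc | rfl
        · have := hq c (-b)
          by_contra! hneg
          nlinarith [mul_pos_of_neg_of_neg hc hneg]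
        · have h1 := hq 1 1
          have h2 := hq 1 (-1)
          have : b = 0 := by linarith
          simp [this]
    rw [abs_of_nonneg hdet, mul_one]
    exact le_max_left _ _
  · simp

open Classical in
/-- Corollary 4.2 (Gaussian-vector content): for a centered Gaussian vector `(Y₁, Y₂, Y₃)`
with covariance matrix `Σ(r)` and `r ≥ 1/8`, with `M` the symmetric matrix with rows
`(Y₁-u, Y₂)`, `(Y₂, Y₃-u)`,
`E[|det M| · 1_{M ⪯ 0}] ≤ u² - 1 + (8r)^{3/2} exp(-u²/(24r-2)) / √(24r-2)`. -/
theorem record_method_expectation_abs_det_nsd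
    {Ω : Type*} [MeasureSpace Ω] [IsProbabilityMeasure (ℙ : Measure Ω)]
    (r : ℝ) (hr : 1 / 8 ≤ r)
    (Y₁ Y₂ Y₃ : Ω → ℝ) (hY₁ : Measurable Y₁) (hY₂ : Measurable Y₂) (hY₃ : Measurable Y₃)
    (hGauss : ∀ t₁ t₂ t₃ : ℝ,
      Measure.map (fun ω => t₁ * Y₁ ω + t₂ * Y₂ ω + t₃ * Y₃ ω) ℙ =
        gaussianReal 0 (Real.toNNReal
          ((12 * r - 1) * t₁ ^ 2 + 4 * r * t₂ ^ 2 + (12 * r - 1) * t₃ ^ 2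
            + 2 * (4 * r - 1) * t₁ * t₃)))
    (u : ℝ) :
    (∫ ω, |(Y₁ ω - u) * (Y₃ ω - u) - (Y₂ ω) ^ 2| *
        (if ∀ v : Fin 2 → ℝ,
            v ⬝ᵥ (!![Y₁ ω - u, Y₂ ω; Y₂ ω, Y₃ ω - u] *ᵥ v) ≤ 0 then (1 : ℝ) else 0)) ≤
      u ^ 2 - 1 + (8 * r) ^ ((3 : ℝ) / 2) * Real.exp (-u ^ 2 / (24 * r - 2))
        / Real.sqrt (24 * r - 2) := by
  have hv : 0 < 4 * r := by linarith
  have hw : 0 ≤ 8 * r - 1 := by linarith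
  set γ := gaussianReal 0 (8 * r - 1).toNNReal
  set δ := gaussianReal 0 (4 * r).toNNReal
  have hlaw : Measure.map (fun ω ↦ ((Y₁ ω + Y₃ ω) / 2, (Y₁ ω - Y₃ ω) / 2, Y₂ ω)) ℙ =
      γ.prod (δ.prod δ) := by
    refine map_prodMk_eq_prod_gaussianReal (by fun_prop) (by fun_prop) hY₂ hw hv.le hv.le
      fun a b c ↦ ?_
    convert! hGauss ((a + b) / 2) c ((a - b) / 2) using 3
    · ring
    · ring
  set g : ℝ × ℝ × ℝ → ℝ := fun p ↦ max ((u - p.1) ^ 2 - p.2.1 ^ 2 - p.2.2 ^ 2) 0 with hg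
  have hgm : Measurable g := by fun_prop
  have hid : Integrable (fun s : ℝ ↦ (u - s) ^ 2) γ :=
    ((memLp_const u).sub (memLp_id_gaussianReal 2)).integrable_sq
  have hgi : Integrable g (γ.prod (δ.prod δ)) := by
    refine (hid.comp_fst (δ.prod δ)).mono' hgm.aestronglyMeasurable (ae_of_all _ fun p ↦ ?_)
    rw [Real.norm_of_nonneg (le_max_right _ _)]
    exact max_le (by nlinarith [sq_nonneg p.2.1, sq_nonneg p.2.2]) (sq_nonneg _)
  have hexp : Integrable (fun s : ℝ ↦ exp (-(u - s) ^ 2 / (2 * (4 * r)))) γ := by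
    refine (integrable_const (1 : ℝ)).mono' (by fun_prop) (ae_of_all _ fun s ↦ ?_)
    rw [Real.norm_of_nonneg (exp_pos _).le, exp_le_one_iff, neg_div]
    exact neg_nonpos.2 (by positivity)
  have hpoint (ω : Ω) : (Y₁ ω - u) * (Y₃ ω - u) - Y₂ ω ^ 2 =
      (u - (Y₁ ω + Y₃ ω) / 2) ^ 2 - ((Y₁ ω - Y₃ ω) / 2) ^ 2 - Y₂ ω ^ 2 := by ring
  have hconst : 2 * (4 * r) * (√(4 * r / (4 * r + (8 * r - 1))) *
      exp (-u ^ 2 / (2 * (4 * r + (8 * r - 1))))) =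
      (8 * r) ^ ((3 : ℝ) / 2) * exp (-u ^ 2 / (24 * r - 2)) / √(24 * r - 2) := by
    have h8 : 0 < 8 * r := by linarith
    have h1 : 4 * r / (4 * r + (8 * r - 1)) = 8 * r / (24 * r - 2) := by
      rw [div_eq_div_iff (by linarith) (by linarith)]
      ring
    have h2 : 2 * (4 * r + (8 * r - 1)) = 24 * r - 2 := by ring
    have h3 : (8 * r) ^ ((3 : ℝ) / 2) = 8 * r * √(8 * r) := by
      rw [show (3 : ℝ) / 2 = 1 + 1 / 2 by norm_num, rpow_add h8, rpow_one, sqrt_eq_rpow]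
    rw [h1, h2, h3, sqrt_div h8.le]
    ring
  calc
    _ ≤ ∫ ω, g ((Y₁ ω + Y₃ ω) / 2, (Y₁ ω - Y₃ ω) / 2, Y₂ ω) := by
      refine integral_mono_of_nonneg (ae_of_all _ fun ω ↦ ?_) ?_ (ae_of_all _ fun ω ↦ ?_)
      · exact mul_nonneg (abs_nonneg _) (by split_ifs <;> simp)
      · rw [← hlaw] at hgi
        exact hgi.comp_measurable (by fun_prop)
      · simp only [hg]
        rw [← hpoint]
        exact abs_det_mul_indicator_le
    _ = ∫ p, g p ∂γ.prod (δ.prod δ) := by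
      rw [← hlaw, integral_map (by fun_prop) hgm.aestronglyMeasurable]
    _ = ∫ s, ((u - s) ^ 2 - 2 * (4 * r) + 2 * (4 * r) * exp (-(u - s) ^ 2 / (2 * (4 * r)))) ∂γ := by
      rw [integral_prod _ hgi]
      simp only [hg, δ, integral_max_sq_sub_sq_sub_sq_gaussianReal hv]
    _ = _ := by
      have hsub : Integrable (fun s : ℝ ↦ (u - s) ^ 2 - 2 * (4 * r)) γ :=
        hid.sub (integrable_const _)
      rw [integral_add hsub (hexp.const_mul _),
        integral_sub hid (integrable_const _), integral_const_mul (2 * (4 * r)),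
        integral_sub_sq_gaussianReal, integral_exp_neg_sub_sq_gaussianReal hw hv, hconst,
        Real.coe_toNNReal _ hw]
      simp
      ring
end

section
/- Let c > 0 and define D(u) = φ(u)·(c·φ(u/c) − u·Φ̄(u/c)). Then D(u) > 0 for u > 0 and liminf_{u → ∞} (−2·log D(u))/u² ≥ 1 + 1/c². -/
open MeasureTheory Real Filter

/-- The standard normal density `φ`. -/
noncomputable def stdGaussianPDF (x : ℝ) : ℝ :=
  (Real.sqrt (2 * Real.pi))⁻¹ * Real.exp (-x ^ 2 / 2)

/-- The standard normal distribution function `Φ`. -/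
noncomputable def stdGaussianCDF (x : ℝ) : ℝ :=
  ∫ t in Set.Iic x, stdGaussianPDF t

/-- The Gaussian tail `Φ̄ = 1 - Φ`. -/
noncomputable def stdGaussianTail (x : ℝ) : ℝ := 1 - stdGaussianCDF x

theorem stdGaussianPDF_eq_gaussianPDFReal :
    stdGaussianPDF = ProbabilityTheory.gaussianPDFReal 0 1 := by
  ext x
  simp [stdGaussianPDF, ProbabilityTheory.gaussianPDFReal]

theorem stdGaussianPDF_pos (x : ℝ) : 0 < stdGaussianPDF x := by
  unfold stdGaussianPDF
  positivity

theorem integrable_stdGaussianPDF : Integrable stdGaussianPDF :=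
  stdGaussianPDF_eq_gaussianPDFReal ▸ ProbabilityTheory.integrable_gaussianPDFReal 0 1

theorem integrable_mul_stdGaussianPDF : Integrable fun t => t * stdGaussianPDF t := by
  refine ((integrable_mul_exp_neg_mul_sq (b := 1 / 2) (by norm_num)).const_mul
    (√(2 * π))⁻¹).congr (ae_of_all _ fun t => ?_)
  simp only [stdGaussianPDF]
  ring_nf

theorem stdGaussianPDF_le_of_le {x y : ℝ} (hx : 0 ≤ x) (hxy : x ≤ y) :
    stdGaussianPDF y ≤ stdGaussianPDF x := by
  unfold stdGaussianPDF
  gcongr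

theorem stdGaussianTail_eq_integral_Ioi (x : ℝ) :
    stdGaussianTail x = ∫ t in Set.Ioi x, stdGaussianPDF t := by
  have h : ∫ t, stdGaussianPDF t = 1 := by
    rw [stdGaussianPDF_eq_gaussianPDFReal]
    exact ProbabilityTheory.integral_gaussianPDFReal_eq_one 0 one_ne_zero
  have h' := intervalIntegral.integral_Iic_add_Ioi (b := x)
    integrable_stdGaussianPDF.integrableOn integrable_stdGaussianPDF.integrableOn
  rw [stdGaussianTail, stdGaussianCDF]
  linarith

theorem stdGaussianTail_nonneg (x : ℝ) : 0 ≤ stdGaussianTail x := by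
  rw [stdGaussianTail_eq_integral_Ioi]
  exact integral_nonneg fun t => (stdGaussianPDF_pos t).le

theorem hasDerivAt_stdGaussianPDF (x : ℝ) :
    HasDerivAt stdGaussianPDF (-(x * stdGaussianPDF x)) x := by
  have h := (((hasDerivAt_pow 2 x).neg.div_const 2).exp).const_mul (√(2 * π))⁻¹
  refine h.congr_deriv ?_
  simp [stdGaussianPDF]
  ring

theorem tendsto_stdGaussianPDF_atTop : Tendsto stdGaussianPDF atTop (nhds 0) := by
  have h : Tendsto (fun x : ℝ => -x ^ 2 / 2) atTop atBot :=
    (tendsto_neg_atTop_atBot.comp (tendsto_pow_atTop two_ne_zero)).atBot_div_const two_pos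
  have h' := (Real.tendsto_exp_atBot.comp h).const_mul (√(2 * π))⁻¹
  rwa [mul_zero] at h'

theorem integral_Ioi_mul_stdGaussianPDF (x : ℝ) :
    ∫ t in Set.Ioi x, t * stdGaussianPDF t = stdGaussianPDF x := by
  have h := integral_Ioi_of_hasDerivAt_of_tendsto' (a := x)
    (fun t _ => hasDerivAt_stdGaussianPDF t)
    integrable_mul_stdGaussianPDF.neg.integrableOn tendsto_stdGaussianPDF_atTop
  rw [integral_neg] at h
  linarith

theorem stdGaussianPDF_sub_mul_tail (x : ℝ) :
    stdGaussianPDF x - x * stdGaussianTail x =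
      ∫ t in Set.Ioi x, (t - x) * stdGaussianPDF t := by
  simp_rw [sub_mul]
  rw [integral_sub integrable_mul_stdGaussianPDF.integrableOn
    (integrable_stdGaussianPDF.const_mul x).integrableOn, integral_const_mul,
    integral_Ioi_mul_stdGaussianPDF, stdGaussianTail_eq_integral_Ioi]

theorem stdGaussianPDF_add_two_le {x : ℝ} (hx : 0 ≤ x) :
    stdGaussianPDF (x + 2) ≤ stdGaussianPDF x - x * stdGaussianTail x := by
  have hint : Integrable fun t => (t - x) * stdGaussianPDF t := by
    simp_rw [sub_mul]
    exact integrable_mul_stdGaussianPDF.sub (integrable_stdGaussianPDF.const_mul x)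
  have hlow : ∀ t ∈ Set.Ioc (x + 1) (x + 2),
      stdGaussianPDF (x + 2) ≤ (t - x) * stdGaussianPDF t := fun t ht => by
    have h := stdGaussianPDF_le_of_le (by linarith [ht.1]) ht.2
    nlinarith [ht.1, stdGaussianPDF_pos t]
  rw [stdGaussianPDF_sub_mul_tail]
  calc stdGaussianPDF (x + 2)
      = ∫ _ in Set.Ioc (x + 1) (x + 2), stdGaussianPDF (x + 2) := by
        rw [setIntegral_const, Real.volume_real_Ioc_of_le (by linarith), smul_eq_mul]
        ring
    _ ≤ ∫ t in Set.Ioc (x + 1) (x + 2), (t - x) * stdGaussianPDF t :=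
        setIntegral_mono_on (integrableOn_const (by simp)) hint.integrableOn
          measurableSet_Ioc hlow
    _ ≤ ∫ t in Set.Ioi x, (t - x) * stdGaussianPDF t := by
        refine setIntegral_mono_set hint.integrableOn ?_ (LE.le.eventuallyLE ?_)
        · exact ae_restrict_of_forall_mem measurableSet_Ioi fun t ht =>
            mul_nonneg (sub_nonneg.2 (le_of_lt ht)) (stdGaussianPDF_pos t).le
        · exact fun t ht => Set.mem_Ioi.2 (by linarith [ht.1])

theorem stdGaussianPDF_sub_mul_tail_le {x : ℝ} (hx : 0 ≤ x) :
    stdGaussianPDF x - x * stdGaussianTail x ≤ stdGaussianPDF x :=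
  sub_le_self _ (mul_nonneg hx (stdGaussianTail_nonneg x))

theorem log_stdGaussianPDF (x : ℝ) :
    log (stdGaussianPDF x) = log (√(2 * π))⁻¹ - x ^ 2 / 2 := by
  rw [stdGaussianPDF, log_mul (by positivity) (by positivity), log_exp]
  ring

theorem log_mul_stdGaussianPDF_mul {c : ℝ} (hc : 0 < c) (x y : ℝ) :
    log (stdGaussianPDF x * (c * stdGaussianPDF y)) =
      log c + 2 * log (√(2 * π))⁻¹ - x ^ 2 / 2 - y ^ 2 / 2 := by
  rw [log_mul (stdGaussianPDF_pos x).ne' (mul_pos hc (stdGaussianPDF_pos y)).ne',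
    log_mul hc.ne' (stdGaussianPDF_pos y).ne', log_stdGaussianPDF, log_stdGaussianPDF]
  ring

/-- For `c > 0` and `D(u) = φ(u)(c φ(u/c) - u Φ̄(u/c))`, one has `D(u) > 0` for
`u > 0` and `liminf_{u → ∞} (-2 log D(u))/u² ≥ 1 + 1/c²`. -/
theorem record_minus_EC_sharpness (c : ℝ) (hc : 0 < c)
    (D : ℝ → ℝ)
    (hD : ∀ u, D u = stdGaussianPDF u *
      (c * stdGaussianPDF (u / c) - u * stdGaussianTail (u / c))) :
    (∀ u > 0, 0 < D u) ∧
    1 + 1 / c ^ 2 ≤ Filter.atTop.liminf (fun u => -2 * Real.log (D u) / u ^ 2) := by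
  have hform : ∀ u, D u = stdGaussianPDF u *
      (c * (stdGaussianPDF (u / c) - u / c * stdGaussianTail (u / c))) := fun u => by
    rw [hD]
    field_simp
  have hlow : ∀ u > 0, stdGaussianPDF u * (c * stdGaussianPDF (u / c + 2)) ≤ D u :=
    fun u hu => by
      rw [hform]
      have := stdGaussianPDF_add_two_le (div_pos hu hc).le
      have := stdGaussianPDF_pos u
      gcongr
  have hupp : ∀ u > 0, D u ≤ stdGaussianPDF u * (c * stdGaussianPDF (u / c)) :=
    fun u hu => by
      rw [hform]
      have := stdGaussianPDF_sub_mul_tail_le (div_pos hu hc).le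
      have := stdGaussianPDF_pos u
      gcongr
  have hprod : ∀ x y, 0 < stdGaussianPDF x * (c * stdGaussianPDF y) := fun x y =>
    mul_pos (stdGaussianPDF_pos x) (mul_pos hc (stdGaussianPDF_pos y))
  have hpos : ∀ u > 0, 0 < D u := fun u hu => (hprod _ _).trans_le (hlow u hu)
  refine ⟨hpos, ?_⟩
  set K := log c + 2 * log (√(2 * π))⁻¹ with hK
  have hinv : Tendsto (fun u : ℝ => u⁻¹) atTop (nhds 0) := tendsto_inv_atTop_zero
  have hlim_low : Tendsto (fun u : ℝ => 1 + 1 / c ^ 2 - 2 * K * u⁻¹ ^ 2) atTop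
      (nhds (1 + 1 / c ^ 2)) := by
    simpa [-one_div] using ((hinv.pow 2).const_mul (2 * K)).const_sub (1 + 1 / c ^ 2)
  have hlim_upp : Tendsto (fun u : ℝ => 1 + (1 / c + 2 * u⁻¹) ^ 2 - 2 * K * u⁻¹ ^ 2) atTop
      (nhds (1 + 1 / c ^ 2)) := by
    simpa using ((((hinv.const_mul 2).const_add (1 / c)).pow 2).const_add 1).sub
      ((hinv.pow 2).const_mul (2 * K))
  have hlim : Tendsto (fun u => -2 * log (D u) / u ^ 2) atTop (nhds (1 + 1 / c ^ 2)) := by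
    refine tendsto_of_tendsto_of_tendsto_of_le_of_le' hlim_low hlim_upp ?_ ?_
    · filter_upwards [eventually_gt_atTop 0] with u hu
      have h := log_le_log (hpos u hu) (hupp u hu)
      rw [log_mul_stdGaussianPDF_mul hc, ← hK] at h
      rw [le_div_iff₀ (by positivity)]
      have e : (1 + 1 / c ^ 2 - 2 * K * u⁻¹ ^ 2) * u ^ 2 =
          -2 * (K - u ^ 2 / 2 - (u / c) ^ 2 / 2) := by
        field_simp
        ring
      linarith
    · filter_upwards [eventually_gt_atTop 0] with u hu
      have h := log_le_log (hprod _ _) (hlow u hu)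
      rw [log_mul_stdGaussianPDF_mul hc, ← hK] at h
      rw [div_le_iff₀ (by positivity)]
      have e : (1 + (1 / c + 2 * u⁻¹) ^ 2 - 2 * K * u⁻¹ ^ 2) * u ^ 2 =
          -2 * (K - u ^ 2 / 2 - (u / c + 2) ^ 2 / 2) := by
        field_simp
        ring
      linarith
  exact hlim.liminf_eq.ge
end
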